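/- For every x ∈ (0, 1], the set 𝒰(x) has Hausdorff dimension 1 (with respect to the Euclidean metric on ℝ). -/

import Mathlib

open scoped ENNReal NNReal Classical

namespace Expansions

/-- Digit sequences over the alphabet `{0,1,…,M}`; index `i : ℕ` represents the
`(i+1)`-st digit `d_{i+1}` of the paper. -/
abbrev Digits (M : ℕ) := ℕ → Fin (M + 1)

/-- `π_q((d_i)) = Σ_{i≥1} d_i / q^i`. -/
noncomputable def piQ (M : ℕ) (q : ℝ) (d : Digits M) : ℝ :=
  ∑' i : ℕ, (d i : ℝ) / q ^ (i + 1)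

/-- `𝒰_q` : the set of real numbers having a unique `q`-expansion. -/
def Uq (M : ℕ) (q : ℝ) : Set ℝ := {x | ∃! d : Digits M, piQ M q d = x}

/-- `𝐔_q` : the set of sequences that are the unique `q`-expansion of their value. -/
def UqSym (M : ℕ) (q : ℝ) : Set (Digits M) :=
  {d | ∀ e : Digits M, piQ M q e = piQ M q d → e = d}

/-- `𝒰(x)` : the set of univoque bases of `x`. -/
def Ubases (M : ℕ) (x : ℝ) : Set ℝ :=
  {q | q ∈ Set.Ioc (1 : ℝ) ((M : ℝ) + 1) ∧ x ∈ Uq M q}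

/-- `q_x = min{M+1, 1+M/x}`. -/
noncomputable def qx (M : ℕ) (x : ℝ) : ℝ := min ((M : ℝ) + 1) (1 + (M : ℝ) / x)

/-- Strict lexicographic order on digit sequences. -/
def lexLt {M : ℕ} (c d : Digits M) : Prop := ∃ n, (∀ i < n, c i = d i) ∧ c n < d n

def lexLe {M : ℕ} (c d : Digits M) : Prop := c = d ∨ lexLt c d

/-- The sequence ends with `0^∞`. -/
def EndsInZero {M : ℕ} (d : Digits M) : Prop := ∃ N, ∀ n ≥ N, d n = 0

/-- `d` is the quasi-greedy `q`-expansion of `x`: the lexicographically largest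
`q`-expansion of `x` not ending with `0^∞`. -/
def IsQuasiGreedy (M : ℕ) (q x : ℝ) (d : Digits M) : Prop :=
  piQ M q d = x ∧ ¬ EndsInZero d ∧
    ∀ e : Digits M, piQ M q e = x → ¬ EndsInZero e → lexLe e d

/-- `Φ_x(q)`: the quasi-greedy `q`-expansion of `x` (junk value if none exists). -/
noncomputable def Phi (M : ℕ) (x q : ℝ) : Digits M :=
  if h : ∃ d : Digits M, IsQuasiGreedy M q x d then h.choose else fun _ => 0

/-- `𝐔(x) = {Φ_x(q) : q ∈ 𝒰(x)}`. -/
def UxSym (M : ℕ) (x : ℝ) : Set (Digits M) := (Phi M x) '' (Ubases M x)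

/-- `ρ((c_i),(d_i)) = (M+1)^{-inf{i ≥ 1 : c_i ≠ d_i}}` (our index `n` represents the
`(n+1)`-st digit, whence the exponent `-(n+1)`); `ρ(c,c) = 0`. -/
noncomputable def rho (M : ℕ) (c d : Digits M) : ℝ :=
  if c = d then 0
  else ((M : ℝ) + 1) ^ (-(((sInf {i | c i ≠ d i} : ℕ) : ℤ) + 1))

/-- Diameter of a set with respect to a distance function, valued in `ℝ≥0∞`. -/
noncomputable def gdiam {X : Type*} (dist : X → X → ℝ) (A : Set X) : ℝ≥0∞ :=
  ⨆ x ∈ A, ⨆ y ∈ A, ENNReal.ofReal (dist x y)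

/-- The `s`-dimensional Hausdorff outer measure with respect to a distance function:
`lim_{δ→0⁺} inf {Σ diam(C n)^s : A ⊆ ⋃ C n, diam (C n) ≤ δ}`. -/
noncomputable def gHMeasure {X : Type*} (dist : X → X → ℝ) (s : ℝ) (A : Set X) : ℝ≥0∞ :=
  ⨆ (δ : ℝ) (_ : 0 < δ),
    ⨅ (C : ℕ → Set X) (_ : A ⊆ ⋃ n, C n)
      (_ : ∀ n, gdiam dist (C n) ≤ ENNReal.ofReal δ),
      ∑' n, gdiam dist (C n) ^ s

/-- Hausdorff dimension with respect to a distance function. -/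
noncomputable def gdimH {X : Type*} (dist : X → X → ℝ) (A : Set X) : ℝ≥0∞ :=
  ⨆ (s : ℝ≥0) (_ : gHMeasure dist (s : ℝ) A = ⊤), (s : ℝ≥0∞)

/-- The generalized golden ratio `q_G`. -/
noncomputable def qG (M : ℕ) : ℝ :=
  if M % 2 = 0 then ((M / 2 : ℕ) : ℝ) + 1
  else (((M / 2 : ℕ) : ℝ) + 1 +
    Real.sqrt (((M / 2 : ℕ) : ℝ) ^ 2 + 6 * ((M / 2 : ℕ) : ℝ) + 5)) / 2

/-- `x_G = M/(q_G - 1)`. -/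
noncomputable def xG (M : ℕ) : ℝ := (M : ℝ) / (qG M - 1)

/-- The Komornik–Loreti constant `q_KL = min 𝒰(1)`. -/
noncomputable def qKL (M : ℕ) : ℝ := sInf (Ubases M 1)

/-- `x_KL = M/(q_KL - 1)`. -/
noncomputable def xKL (M : ℕ) : ℝ := (M : ℝ) / (qKL M - 1)

/-- `X_iso`: the set of `x > 0` such that `𝒰(x)` contains an isolated point. -/
def Xiso (M : ℕ) : Set ℝ :=
  {x | 0 < x ∧ ∃ q ∈ Ubases M x, ∃ ε > 0, Ubases M x ∩ Set.Ioo (q - ε) (q + ε) = {q}}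

/-- The bifurcation set `𝒱 = {q ∈ (1,M+1] : 𝐔_r ≠ 𝐔_q for all r > q}`. -/
def Vset (M : ℕ) : Set ℝ :=
  {q | q ∈ Set.Ioc (1 : ℝ) ((M : ℝ) + 1) ∧
    ∀ r ∈ Set.Ioc (1 : ℝ) ((M : ℝ) + 1), q < r → UqSym M r ≠ UqSym M q}

/-- The Thue–Morse sequence `τ_i` = parity of the binary digit sum of `i`. -/
def tm (i : ℕ) : ℕ := (Nat.digits 2 i).sum % 2


lemma hasSum_const_div_pow {q : ℝ} (hq : 1 < q) (c : ℝ) :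
    HasSum (fun i : ℕ => c / q ^ (i + 1)) (c / (q - 1)) := by
  have h := (hasSum_geometric_of_lt_one (by positivity) (inv_lt_one_of_one_lt₀ hq)).mul_left (c / q)
  have h0 : q - 1 ≠ 0 := by linarith
  convert! h using 1
  · ext i
    rw [pow_succ, inv_pow]
    field_simp
  · field_simp

lemma digit_le {M : ℕ} (a : Fin (M + 1)) : ((a : ℕ) : ℝ) ≤ M := by
  exact_mod_cast Nat.lt_succ_iff.mp a.isLt

lemma summable_piQ {M : ℕ} {q : ℝ} (hq : 1 < q) (d : Digits M) :
    Summable (fun i : ℕ => (d i : ℝ) / q ^ (i + 1)) := by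
  refine Summable.of_nonneg_of_le (fun i => by positivity) (fun i => ?_)
    (hasSum_const_div_pow hq (M : ℝ)).summable
  gcongr
  exact Nat.lt_succ_iff.mp (d i).isLt

lemma piQ_nonneg {M : ℕ} {q : ℝ} (hq : 1 < q) (d : Digits M) : 0 ≤ piQ M q d :=
  tsum_nonneg fun i => by positivity

lemma piQ_rev {M : ℕ} {q : ℝ} (hq : 1 < q) (d : Digits M) :
    piQ M q (fun i => (d i).rev) = M / (q - 1) - piQ M q d := by
  rw [piQ, piQ, ← (hasSum_const_div_pow hq (M : ℝ)).tsum_eq,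
    ← (hasSum_const_div_pow hq (M : ℝ)).summable.tsum_sub (summable_piQ hq d)]
  refine tsum_congr fun i => ?_
  have h := Fin.rev_add_cast (d i)
  have h' : (((d i).rev : ℕ) : ℝ) + ((d i : ℕ) : ℝ) = M := by exact_mod_cast h
  rw [← h']
  ring

lemma piQ_le {M : ℕ} {q : ℝ} (hq : 1 < q) (d : Digits M) : piQ M q d ≤ M / (q - 1) := by
  linarith [piQ_nonneg hq fun i => (d i).rev, piQ_rev hq d]

lemma piQ_eq_sum_add {M : ℕ} {q : ℝ} (hq : 1 < q) (d : Digits M) (n : ℕ) :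
    piQ M q d = ∑ i ∈ Finset.range n, (d i : ℝ) / q ^ (i + 1) +
      piQ M q (fun i => d (i + n)) / q ^ n := by
  rw [piQ, piQ, ← (summable_piQ hq d).sum_add_tsum_nat_add n, ← tsum_div_const]
  congr 1
  refine tsum_congr fun i => ?_
  rw [div_div, ← pow_add]
  ring_nf

lemma inv_pow_le_piQ {M : ℕ} {q : ℝ} (hq : 1 < q) {d : Digits M} {j : ℕ} (hj : d j ≠ 0) :
    1 / q ^ (j + 1) ≤ piQ M q d := by
  refine le_trans ?_ ((summable_piQ hq d).le_tsum j fun i _ => by positivity)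
  gcongr
  have : (d j : ℕ) ≠ 0 := fun h => hj (Fin.ext h)
  exact_mod_cast Nat.one_le_iff_ne_zero.mpr this

lemma piQ_le_sub_inv_pow {M : ℕ} {q : ℝ} (hq : 1 < q) {d : Digits M} {j : ℕ}
    (hj : d j ≠ Fin.last M) : piQ M q d ≤ M / (q - 1) - 1 / q ^ (j + 1) := by
  have h : 1 / q ^ (j + 1) ≤ piQ M q fun i => (d i).rev :=
    inv_pow_le_piQ hq (by simpa [Fin.rev_eq_iff] using hj)
  linarith [piQ_rev hq d]

/-- Quantitative comparison of two sequences at their first difference. -/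
lemma div_pow_le_piQ_sub {M : ℕ} {q : ℝ} (hq : 1 < q) {d e : Digits M} {m : ℕ}
    (heq : ∀ i < m, d i = e i) (hlt : d m < e m) {c : ℝ}
    (hc : c ≤ 1 + piQ M q (fun i => e (i + (m + 1))) - piQ M q (fun i => d (i + (m + 1)))) :
    c / q ^ (m + 1) ≤ piQ M q e - piQ M q d := by
  have h1 : (d m : ℝ) + 1 ≤ (e m : ℝ) := by exact_mod_cast hlt
  have h2 : ∑ i ∈ Finset.range m, (d i : ℝ) / q ^ (i + 1) =
      ∑ i ∈ Finset.range m, (e i : ℝ) / q ^ (i + 1) :=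
    Finset.sum_congr rfl fun i hi => by rw [heq i (Finset.mem_range.mp hi)]
  rw [piQ_eq_sum_add hq d (m + 1), piQ_eq_sum_add hq e (m + 1), Finset.sum_range_succ,
    Finset.sum_range_succ, h2]
  have h3 : c / q ^ (m + 1) ≤ ((e m : ℝ) + piQ M q (fun i => e (i + (m + 1))) -
      ((d m : ℝ) + piQ M q (fun i => d (i + (m + 1))))) / q ^ (m + 1) := by
    gcongr
    linarith
  rw [sub_div, add_div, add_div] at h3
  linarith

lemma exists_first_ne {M : ℕ} {d e : Digits M} (h : d ≠ e) :
    ∃ m, (∀ i < m, d i = e i) ∧ d m ≠ e m := by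
  have h' : ∃ m, d m ≠ e m := Function.ne_iff.mp h
  exact ⟨Nat.find h', fun i hi => not_not.mp (Nat.find_min h' hi), Nat.find_spec h'⟩

lemma mem_UqSym_of_tail_bounds {M : ℕ} {q : ℝ} (hq : 1 < q) {d : Digits M}
    (h1 : ∀ i, 1 ≤ i → piQ M q (fun j => d (j + i)) < 1)
    (h2 : ∀ i, 1 ≤ i → M / (q - 1) - 1 < piQ M q (fun j => d (j + i))) :
    d ∈ UqSym M q := by
  intro e he
  by_contra hne
  obtain ⟨m, hm, hmne⟩ := exists_first_ne hne
  have ha := h1 (m + 1) (by lia)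
  have hb := h2 (m + 1) (by lia)
  rcases lt_or_gt_of_ne hmne with hlt | hlt
  · have h := div_pow_le_piQ_sub hq hm hlt le_rfl
    have hle := piQ_le hq fun i => e (i + (m + 1))
    have : 0 < 1 + piQ M q (fun i => d (i + (m + 1))) - piQ M q (fun i => e (i + (m + 1))) := by
      linarith
    have := div_pos this (pow_pos (one_pos.trans hq) (m + 1))
    linarith
  · have h := div_pow_le_piQ_sub hq (fun i hi => (hm i hi).symm) hlt le_rfl
    have hle := piQ_nonneg hq fun i => e (i + (m + 1))
    have : 0 < 1 + piQ M q (fun i => e (i + (m + 1))) - piQ M q (fun i => d (i + (m + 1))) := by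
      linarith
    have := div_pos this (pow_pos (one_pos.trans hq) (m + 1))
    linarith

lemma exists_piQ_lipschitz (M : ℕ) : ∃ K : ℝ, 0 < K ∧ ∀ d : Digits M, ∀ p q : ℝ,
    3 / 2 ≤ p → 3 / 2 ≤ q → |piQ M p d - piQ M q d| ≤ K * |p - q| := by
  have hs : Summable fun i : ℕ => (M : ℝ) * (((i : ℝ) + 1) * (2 / 3 : ℝ) ^ i) := by
    have ha := summable_pow_mul_geometric_of_norm_lt_one 1 (r := (2 / 3 : ℝ))
      (by rw [Real.norm_eq_abs, abs_of_pos] <;> norm_num)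
    have hb := summable_geometric_of_lt_one (r := (2 / 3 : ℝ)) (by norm_num) (by norm_num)
    refine ((ha.add hb).mul_left (M : ℝ)).congr fun i => ?_
    ring
  refine ⟨∑' i : ℕ, (M : ℝ) * (((i : ℝ) + 1) * (2 / 3 : ℝ) ^ i) + 1,
    add_pos_of_nonneg_of_pos (tsum_nonneg fun i => by positivity) one_pos, ?_⟩
  intro d p q hp hq
  have hp0 : 0 < p := by linarith
  have hq0 : 0 < q := by linarith
  have hinv : ∀ {r : ℝ}, 3 / 2 ≤ r → r⁻¹ ≤ 2 / 3 := fun {r} hr => by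
    have := inv_anti₀ (by norm_num) hr
    norm_num at this ⊢
    exact this
  have hpq : |p⁻¹ - q⁻¹| ≤ |p - q| := by
    rw [inv_sub_inv hp0.ne' hq0.ne', abs_div, abs_sub_comm, abs_of_pos (mul_pos hp0 hq0)]
    exact div_le_self (abs_nonneg _) (by nlinarith)
  have hterm : ∀ i : ℕ, |(d i : ℝ) / p ^ (i + 1) - (d i : ℝ) / q ^ (i + 1)| ≤
      (M : ℝ) * (((i : ℝ) + 1) * (2 / 3 : ℝ) ^ i) * |p - q| := fun i => by
    have h1 := abs_pow_sub_pow_le p⁻¹ q⁻¹ (i + 1)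
    have h2 : max |p⁻¹| |q⁻¹| ≤ 2 / 3 := by
      rw [abs_of_pos (inv_pos.mpr hp0), abs_of_pos (inv_pos.mpr hq0)]
      exact max_le (hinv hp) (hinv hq)
    rw [div_eq_mul_inv, div_eq_mul_inv, ← mul_sub, abs_mul, ← inv_pow, ← inv_pow,
      abs_of_nonneg (by positivity : (0 : ℝ) ≤ (d i : ℝ)), mul_assoc]
    refine mul_le_mul (digit_le _) (h1.trans ?_) (abs_nonneg _) (by positivity)
    rw [Nat.add_sub_cancel]
    push_cast
    calc |p⁻¹ - q⁻¹| * ((i : ℝ) + 1) * max |p⁻¹| |q⁻¹| ^ i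
        ≤ |p - q| * ((i : ℝ) + 1) * (2 / 3 : ℝ) ^ i := by gcongr
      _ = _ := by ring
  have hsp := summable_piQ (by linarith : 1 < p) d
  have hsq := summable_piQ (by linarith : 1 < q) d
  rw [piQ, piQ, ← hsp.tsum_sub hsq]
  have hb : ‖∑' i : ℕ, ((d i : ℝ) / p ^ (i + 1) - (d i : ℝ) / q ^ (i + 1))‖ ≤
      (∑' i : ℕ, (M : ℝ) * (((i : ℝ) + 1) * (2 / 3 : ℝ) ^ i)) * |p - q| :=
    tsum_of_norm_bounded (hs.hasSum.mul_right _) hterm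
  rw [Real.norm_eq_abs] at hb
  nlinarith [abs_nonneg (p - q)]

/-- A digit sequence whose partial sums approximate `x` strictly from below. -/
lemma exists_quasiGreedy_base (M : ℕ) {x : ℝ} (hx : x ∈ Set.Ioc (0 : ℝ) 1) :
    ∃ X : Digits M, ∀ n,
      ∑ i ∈ Finset.range n, (X i : ℝ) / ((M : ℝ) + 1) ^ (i + 1) < x ∧
      x ≤ ∑ i ∈ Finset.range n, (X i : ℝ) / ((M : ℝ) + 1) ^ (i + 1) + 1 / ((M : ℝ) + 1) ^ n := by
  set b : ℝ := (M : ℝ) + 1 with hb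
  have hb0 : 0 < b := by positivity
  let a : ℕ → ℤ := fun n => ⌈x * b ^ n⌉ - 1
  have ha1 : ∀ n, (a n : ℝ) < x * b ^ n := fun n => by
    have := Int.ceil_lt_add_one (x * b ^ n)
    simp only [a]
    push_cast
    linarith
  have ha2 : ∀ n, x * b ^ n ≤ (a n : ℝ) + 1 := fun n => by
    have := Int.le_ceil (x * b ^ n)
    simp only [a]
    push_cast
    linarith
  have hd : ∀ n, ∃ c : Fin (M + 1), (a (n + 1) : ℝ) = b * a n + (c : ℕ) := fun n => by
    have h1 : ((M : ℤ) + 1) * a n < a (n + 1) + 1 := by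
      have h : b * (a n : ℝ) < (a (n + 1) : ℝ) + 1 := by
        have := ha2 (n + 1)
        have := mul_lt_mul_of_pos_left (ha1 n) hb0
        rw [pow_succ] at *
        linarith
      rw [hb] at h
      exact_mod_cast h
    have h2 : a (n + 1) < ((M : ℤ) + 1) * (a n + 1) := by
      have h : (a (n + 1) : ℝ) < b * ((a n : ℝ) + 1) := by
        have := ha1 (n + 1)
        have := mul_le_mul_of_nonneg_left (ha2 n) hb0.le
        rw [pow_succ] at *
        linarith
      rw [hb] at h
      exact_mod_cast h
    obtain ⟨c, hc⟩ := Int.eq_ofNat_of_zero_le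
      (show 0 ≤ a (n + 1) - ((M : ℤ) + 1) * a n by lia)
    refine ⟨⟨c, by grind⟩, ?_⟩
    have : a (n + 1) = ((M : ℤ) + 1) * a n + c := by lia
    rw [this, hb]
    push_cast
    ring
  choose X hX using hd
  have hsum : ∀ n, ∑ i ∈ Finset.range n, (X i : ℝ) / b ^ (i + 1) = a n / b ^ n := by
    intro n
    induction n with
    | zero =>
      have : a 0 = 0 := by
        have : ⌈x⌉ = 1 := by
          rw [Int.ceil_eq_iff]
          norm_num
          exact hx
        simp [a, this]
      simp [this]
    | succ n ih =>
      rw [Finset.sum_range_succ, ih, hX n]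
      field_simp
      ring
  refine ⟨X, fun n => ?_⟩
  have hbn : 0 < b ^ n := by positivity
  rw [hsum, ← add_div, div_lt_iff₀ hbn, le_div_iff₀ hbn]
  exact ⟨ha1 n, ha2 n⟩

lemma exists_digit_ne_zero {M : ℕ} (hM : 0 < M) {x : ℝ} {X : Digits M}
    (hX : ∀ n, ∑ i ∈ Finset.range n, (X i : ℝ) / ((M : ℝ) + 1) ^ (i + 1) < x ∧
      x ≤ ∑ i ∈ Finset.range n, (X i : ℝ) / ((M : ℝ) + 1) ^ (i + 1) + 1 / ((M : ℝ) + 1) ^ n)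
    (n : ℕ) : ∃ m ≥ n, X m ≠ 0 := by
  by_contra! h
  have hs : ∀ m, ∑ i ∈ Finset.range (n + m), (X i : ℝ) / ((M : ℝ) + 1) ^ (i + 1) =
      ∑ i ∈ Finset.range n, (X i : ℝ) / ((M : ℝ) + 1) ^ (i + 1) := fun m => by
    rw [Finset.sum_range_add]
    simp [h]
  have hM' : (0 : ℝ) < M := by exact_mod_cast hM
  obtain ⟨m, hm⟩ := exists_pow_lt_of_lt_one (sub_pos.mpr (hX n).1)
    (inv_lt_one_of_one_lt₀ (by linarith : (1 : ℝ) < (M : ℝ) + 1))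
  have h1 := (hX (n + m)).2
  rw [hs m] at h1
  have h2 : 1 / ((M : ℝ) + 1) ^ (n + m) ≤ (((M : ℝ) + 1)⁻¹) ^ m := by
    rw [inv_pow, one_div]
    gcongr
    · linarith
    · lia
  linarith

lemma mul_dimH_range_le {ι : Type*} (f g : ι → ℝ) {C r : ℝ≥0} (hr : 0 < r)
    (h : ∀ u v, |g u - g v| ≤ C * |f u - f v| ^ (r : ℝ)) :
    (r : ℝ≥0∞) * dimH (Set.range g) ≤ dimH (Set.range f) := by
  rcases isEmpty_or_nonempty ι with hι | hι
  · simp [Set.range_eq_empty]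
  have hfi : ∀ u, f (Function.invFun f (f u)) = f u := fun u => Function.invFun_eq ⟨u, rfl⟩
  have hgi : ∀ u, g (Function.invFun f (f u)) = g u := fun u => by
    have := h (Function.invFun f (f u)) u
    rw [hfi, sub_self, abs_zero, Real.zero_rpow (by positivity), mul_zero] at this
    exact sub_eq_zero.mp (abs_nonpos_iff.mp this)
  have hh : HolderOnWith C r (g ∘ Function.invFun f) (Set.range f) := by
    rintro _ ⟨u, rfl⟩ _ ⟨v, rfl⟩
    simp only [Function.comp, hgi]
    rw [edist_dist, edist_dist, Real.dist_eq, Real.dist_eq,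
      ENNReal.ofReal_rpow_of_nonneg (abs_nonneg _) r.coe_nonneg,
      ← ENNReal.ofReal_coe_nnreal (p := C), ← ENNReal.ofReal_mul C.coe_nonneg]
    exact ENNReal.ofReal_le_ofReal (h u v)
  have himg : (g ∘ Function.invFun f) '' Set.range f = Set.range g := by
    rw [← Set.range_comp]
    congr 1
    ext u
    exact hgi u
  have := hh.dimH_image_le hr
  rw [himg, ENNReal.le_div_iff_mul_le (Or.inl (by exact_mod_cast hr.ne'))
    (Or.inl ENNReal.coe_ne_top)] at this
  rwa [mul_comm]

/-- The sequence whose blocks of length `L + 2` start with the digits `0, M`, the other digits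
being read off successively from `u`. -/
def blockSeq (M L : ℕ) (u : Digits M) : Digits M := fun i =>
  if i % (L + 2) = 0 then 0
  else if i % (L + 2) = 1 then Fin.last M
  else u (i / (L + 2) * L + (i % (L + 2) - 2))

/-- Both every digit different from `0` and every digit different from `M` recurs with gaps
less than `N`. -/
def BoundedGaps {M : ℕ} (N : ℕ) (t : Digits M) : Prop :=
  ∀ i, (∃ j < N, t (j + i) ≠ 0) ∧ ∃ j < N, t (j + i) ≠ Fin.last M

lemma blockSeq_zero (M L : ℕ) (u : Digits M) : blockSeq M L u 0 = 0 := by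
  simp [blockSeq]

lemma boundedGaps_blockSeq {M : ℕ} (hM : 0 < M) (L : ℕ) (u : Digits M) :
    BoundedGaps (L + 4) (blockSeq M L u) := by
  intro i
  have hne : (0 : Fin (M + 1)) ≠ Fin.last M := fun h => by
    have := congrArg Fin.val h
    simp at this
    lia
  have h1 := Nat.div_add_mod i (L + 2)
  have h2 := Nat.mod_lt i (show 0 < L + 2 by lia)
  refine ⟨⟨L + 3 - i % (L + 2), by lia, ?_⟩, ⟨L + 2 - i % (L + 2), by lia, ?_⟩⟩
  · have : L + 3 - i % (L + 2) + i = 1 + (L + 2) * (i / (L + 2) + 1) := by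
      rw [mul_add]
      lia
    rw [this]
    simpa [blockSeq, Nat.add_mul_mod_self_left] using hne.symm
  · have : L + 2 - i % (L + 2) + i = (L + 2) * (i / (L + 2) + 1) := by
      rw [mul_add]
      lia
    rw [this]
    simpa [blockSeq] using hne

lemma eq_of_blockSeq_eq {M L : ℕ} {u v : Digits M} {m : ℕ}
    (h : ∀ i < m, blockSeq M L u i = blockSeq M L v i) :
    ∀ k < m / (L + 2) * L, u k = v k := by
  intro k hk
  have hL : 0 < L := Nat.pos_of_ne_zero fun h0 => by simp [h0] at hk
  have h1 : k / L < m / (L + 2) := Nat.div_lt_of_lt_mul (by rwa [mul_comm])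
  have h2 := Nat.mod_lt k hL
  have h3 : (2 + k % L) % (L + 2) = 2 + k % L := Nat.mod_eq_of_lt (by lia)
  have h4 : (2 + k % L + (L + 2) * (k / L)) / (L + 2) = k / L := by
    rw [Nat.add_mul_div_left _ _ (by lia), Nat.div_eq_of_lt (by lia), zero_add]
  have h5 : 2 + k % L + (L + 2) * (k / L) < m := by
    have ha := Nat.mul_le_mul_left (L + 2) (Nat.succ_le_of_lt h1)
    have hb := Nat.mul_div_le m (L + 2)
    rw [Nat.mul_succ] at ha
    lia
  have h6 := h _ h5
  have h7 : k / L * L + (2 + k % L - 2) = k := by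
    rw [Nat.add_sub_cancel_left, mul_comm]
    exact Nat.div_add_mod k L
  simp only [blockSeq, Nat.add_mul_mod_self_left, h3, h4, h7] at h6
  rwa [if_neg (by lia), if_neg (by lia), if_neg (by lia), if_neg (by lia)] at h6

/-- The first `n` digits of `X` followed by `t`. -/
def appendAt {M : ℕ} (X : Digits M) (n : ℕ) (t : Digits M) : Digits M := fun i =>
  if i < n then X i else t (i - n)

lemma appendAt_of_lt {M : ℕ} (X t : Digits M) {n i : ℕ} (h : i < n) : appendAt X n t i = X i :=
  if_pos h

lemma appendAt_add {M : ℕ} (X t : Digits M) (n i : ℕ) : appendAt X n t (i + n) = t i := by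
  simp [appendAt]

lemma tail_appendAt {M : ℕ} (X t : Digits M) {n i : ℕ} (h : n ≤ i) :
    (fun j => appendAt X n t (j + i)) = fun j => t (j + (i - n)) := by
  funext j
  rw [← appendAt_add X t n]
  congr 1
  lia

lemma piQ_appendAt {M : ℕ} {q : ℝ} (hq : 1 < q) (X t : Digits M) (n : ℕ) :
    piQ M q (appendAt X n t) =
      ∑ i ∈ Finset.range n, (X i : ℝ) / q ^ (i + 1) + piQ M q t / q ^ n := by
  rw [piQ_eq_sum_add hq _ n]
  congr 1
  · exact Finset.sum_congr rfl fun i hi => by rw [appendAt_of_lt X t (Finset.mem_range.mp hi)]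
  · simp only [appendAt_add]

lemma BoundedGaps.piQ_tail_bounds {M N : ℕ} {t : Digits M} (ht : BoundedGaps N t) {b q : ℝ}
    (hq : 1 < q) (hqb : q ≤ b) (hη : M / (q - 1) - 1 < 1 / b ^ N) (i : ℕ) :
    1 / b ^ N ≤ piQ M q (fun j => t (j + i)) ∧ piQ M q (fun j => t (j + i)) < 1 := by
  have hpow : ∀ j < N, 1 / b ^ N ≤ 1 / q ^ (j + 1) := fun j hj => by
    have h1 : q ^ (j + 1) ≤ q ^ N := pow_le_pow_right₀ hq.le hj
    have h2 : q ^ N ≤ b ^ N := by gcongr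
    have h3 : 0 < q ^ (j + 1) := by positivity
    exact one_div_le_one_div_of_le h3 (h1.trans h2)
  obtain ⟨⟨j, hj, hj'⟩, ⟨l, hl, hl'⟩⟩ := ht i
  refine ⟨(hpow j hj).trans (inv_pow_le_piQ hq (d := fun j => t (j + i)) hj'), ?_⟩
  have := piQ_le_sub_inv_pow hq (d := fun j => t (j + i)) hl'
  linarith [hpow l hl]

lemma sum_digits_antitone {M : ℕ} {p q : ℝ} (hp : 0 < p) (hpq : p ≤ q) (X : Digits M) (n : ℕ) :
    ∑ i ∈ Finset.range n, (X i : ℝ) / q ^ (i + 1) ≤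
      ∑ i ∈ Finset.range n, (X i : ℝ) / p ^ (i + 1) := by
  gcongr

lemma sub_div_pow_le_sum_sub {M : ℕ} {p q : ℝ} (hp : 1 ≤ p) (hpq : p ≤ q) (X : Digits M)
    {k n : ℕ} (hk : k < n) (hXk : X k ≠ 0) :
    (q - p) / q ^ (k + 2) ≤ ∑ i ∈ Finset.range n, (X i : ℝ) / p ^ (i + 1) -
      ∑ i ∈ Finset.range n, (X i : ℝ) / q ^ (i + 1) := by
  have hp0 : 0 < p := by linarith
  have hq0 : 0 < q := by linarith
  rw [← Finset.sum_sub_distrib]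
  have hnn : ∀ i ∈ Finset.range n, 0 ≤ (X i : ℝ) / p ^ (i + 1) - (X i : ℝ) / q ^ (i + 1) :=
    fun i _ => sub_nonneg.mpr (by gcongr)
  refine le_trans ?_ (Finset.single_le_sum hnn (Finset.mem_range.mpr hk))
  have h1 : (1 : ℝ) ≤ (X k : ℝ) := by
    have : (X k : ℕ) ≠ 0 := fun h => hXk (Fin.ext h)
    exact_mod_cast Nat.one_le_iff_ne_zero.mpr this
  have h2 : (q - p) / q ^ (k + 2) ≤ 1 / p ^ (k + 1) - 1 / q ^ (k + 1) := by
    have h3 : 1 / (p * q ^ k) ≤ 1 / p ^ (k + 1) := by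
      rw [pow_succ']
      gcongr
    have h4 : (q - p) / q ^ (k + 2) ≤ (q - p) / (p * q ^ (k + 1)) := by
      have : p * q ^ (k + 1) ≤ q ^ (k + 2) := by
        rw [pow_succ' q (k + 1)]
        gcongr
      have := sub_nonneg.mpr hpq
      gcongr
    have h5 : (q - p) / (p * q ^ (k + 1)) = 1 / (p * q ^ k) - 1 / q ^ (k + 1) := by
      field_simp
      ring
    linarith
  have h3 : 0 ≤ 1 / p ^ (k + 1) - 1 / q ^ (k + 1) :=
    sub_nonneg.mpr (by gcongr)
  calc (q - p) / q ^ (k + 2) ≤ 1 * (1 / p ^ (k + 1) - 1 / q ^ (k + 1)) := by linarith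
    _ ≤ (X k : ℝ) * (1 / p ^ (k + 1) - 1 / q ^ (k + 1)) := by gcongr
    _ = _ := by ring

lemma pow_div_pow_lt {b : ℝ} (hb : 1 < b) {r s n : ℕ} (h : s + r < n) :
    b ^ r / b ^ n < 1 / b ^ s := by
  have hb0 : 0 < b := by linarith
  rw [div_lt_div_iff₀ (by positivity) (by positivity), ← pow_add, one_mul]
  exact pow_lt_pow_right₀ hb (by lia)

/-- Bounds for bases close to `M + 1`. -/
lemma near_top_bounds {M : ℕ} (hM : 0 < M) {k n : ℕ} (hkn : k + 3 < n) {q : ℝ}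
    (hq : (M : ℝ) + 1 - ((M : ℝ) + 1) ^ (k + 2) / ((M : ℝ) + 1) ^ n ≤ q) :
    3 / 2 ≤ q ∧ (M : ℝ) / (q - 1) - 1 ≤ ((M : ℝ) + 1) ^ (k + 3) / ((M : ℝ) + 1) ^ n := by
  have hM' : (1 : ℝ) ≤ M := by exact_mod_cast hM
  have h1 := pow_div_pow_lt (b := (M : ℝ) + 1) (by linarith) (r := k + 3) (s := 0) (n := n)
    (by lia)
  set h : ℝ := ((M : ℝ) + 1) ^ (k + 2) / ((M : ℝ) + 1) ^ n with hh
  have h2 : ((M : ℝ) + 1) ^ (k + 3) / ((M : ℝ) + 1) ^ n = ((M : ℝ) + 1) * h := by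
    rw [hh, pow_succ']
    ring
  have h0 : 0 < h := by positivity
  rw [h2] at h1 ⊢
  norm_num at h1
  have h3 : 3 / 2 ≤ q := by nlinarith
  refine ⟨h3, ?_⟩
  rw [sub_le_iff_le_add, div_le_iff₀ (by linarith)]
  nlinarith [mul_nonneg (sub_nonneg.mpr hM') h0.le, mul_nonneg (sub_nonneg.mpr h3) h0.le,
    mul_nonneg (sub_nonneg.mpr h3) (mul_nonneg (sub_nonneg.mpr hM') h0.le)]

lemma exists_univoque_base {M : ℕ} (hM : 0 < M) {x : ℝ} {X : Digits M}
    (hX : ∀ n, ∑ i ∈ Finset.range n, (X i : ℝ) / ((M : ℝ) + 1) ^ (i + 1) < x ∧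
      x ≤ ∑ i ∈ Finset.range n, (X i : ℝ) / ((M : ℝ) + 1) ^ (i + 1) + 1 / ((M : ℝ) + 1) ^ n)
    {N k l n : ℕ} (hXk : X k ≠ 0) (hXl : X l ≠ 0) (hXn : X n ≠ 0) (hl : N + k + 4 ≤ l)
    (hn : l + k + 4 < n) {t : Digits M} (ht0 : t 0 = 0) (ht : BoundedGaps N t) :
    ∃ q, q ∈ Ubases M x ∧ piQ M q (appendAt X n t) = x ∧
      (M : ℝ) + 1 - ((M : ℝ) + 1) ^ (k + 2) / ((M : ℝ) + 1) ^ n ≤ q := by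
  have hM' : (1 : ℝ) ≤ M := by exact_mod_cast hM
  set b : ℝ := (M : ℝ) + 1 with hb
  have hb1 : 1 < b := by linarith
  set q₀ : ℝ := b - b ^ (k + 2) / b ^ n with hq₀
  have hnear : ∀ q, q₀ ≤ q → 3 / 2 ≤ q ∧ (M : ℝ) / (q - 1) - 1 ≤ b ^ (k + 3) / b ^ n :=
    fun q hq => near_top_bounds hM (by lia) hq
  have hη : ∀ {s}, s + (k + 3) < n → b ^ (k + 3) / b ^ n < 1 / b ^ s := fun h =>
    pow_div_pow_lt hb1 h
  have hq₀b : q₀ ≤ b := by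
    have : 0 < b ^ (k + 2) / b ^ n := by positivity
    linarith
  have htop : piQ M b (appendAt X n t) < x := by
    have h1 : piQ M b t ≤ 1 / b := by
      rw [piQ_eq_sum_add hb1 t 1]
      have h2 := piQ_le hb1 fun i => t (i + 1)
      rw [hb, add_sub_cancel_right, div_self (by positivity)] at h2
      rw [Finset.sum_range_one, ht0, pow_one]
      simp only [Fin.val_zero, Nat.cast_zero, zero_div, zero_add]
      gcongr
    have h3 := (hX (n + 1)).1
    rw [Finset.sum_range_succ] at h3
    have h4 : 1 / b ^ (n + 1) ≤ (X n : ℝ) / b ^ (n + 1) := by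
      gcongr
      have : (X n : ℕ) ≠ 0 := fun h => hXn (Fin.ext h)
      exact_mod_cast Nat.one_le_iff_ne_zero.mpr this
    have h5 : piQ M b t / b ^ n ≤ 1 / b ^ (n + 1) := by
      rw [pow_succ', ← div_div]
      gcongr
    rw [piQ_appendAt hb1]
    linarith
  have hbot : x ≤ piQ M q₀ (appendAt X n t) := by
    have h1 : 1 < q₀ := by linarith [(hnear q₀ le_rfl).1]
    rw [piQ_appendAt h1]
    have h2 := sub_div_pow_le_sum_sub h1.le hq₀b X (show k < n by lia) hXk
    have h3 : (b - q₀) / b ^ (k + 2) = 1 / b ^ n := by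
      rw [hq₀, sub_sub_cancel]
      field_simp
    have h4 : 0 ≤ piQ M q₀ t / q₀ ^ n := div_nonneg (piQ_nonneg h1 t) (by positivity)
    linarith [(hX n).2]
  obtain ⟨K, hK, hlip⟩ := exists_piQ_lipschitz M
  have hcont : ContinuousOn (fun q => piQ M q (appendAt X n t)) (Set.Icc q₀ b) := by
    refine (LipschitzOnWith.of_dist_le_mul (K := K.toNNReal) fun p hp q hq => ?_).continuousOn
    rw [Real.dist_eq, Real.dist_eq, Real.coe_toNNReal _ hK.le]
    exact hlip _ _ _ (hnear p hp.1).1 (hnear q hq.1).1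
  obtain ⟨q, ⟨hq1, hq2⟩, hqx⟩ := intermediate_value_Icc' hq₀b hcont ⟨htop.le, hbot⟩
  simp only at hqx
  obtain ⟨hq32, hqη⟩ := hnear q hq1
  have hq : 1 < q := by linarith
  have hqb : q < b := lt_of_le_of_ne hq2 fun h => by
    rw [h] at hqx
    linarith
  have htail := ht.piQ_tail_bounds hq hq2 (hqη.trans_lt (hη (by lia)))
  refine ⟨q, ⟨⟨hq, hq2⟩, appendAt X n t, hqx, fun e he => ?_⟩, hqx, hq1⟩
  refine mem_UqSym_of_tail_bounds hq (fun i hi => ?_) (fun i _ => ?_) e (he.trans hqx.symm)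
  · by_cases hin : n ≤ i
    · rw [tail_appendAt X t hin]
      exact (htail _).2
    · push Not at hin
      have h1 := piQ_eq_sum_add hq (appendAt X n t) i
      rw [hqx, Finset.sum_congr rfl fun j hj => by
        rw [appendAt_of_lt X t ((Finset.mem_range.mp hj).trans hin)]] at h1
      have h2 := sum_digits_antitone (by linarith) hq2 X i
      have h3 := (hX i).2
      have h4 : piQ M q (fun j => appendAt X n t (j + i)) / q ^ i ≤ 1 / b ^ i := by linarith
      have h5 : 1 / b ^ i < 1 / q ^ i :=
        one_div_lt_one_div_of_lt (by positivity) (pow_lt_pow_left₀ hqb (by linarith) (by lia))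
      exact (div_lt_div_iff_of_pos_right (by positivity)).mp (h4.trans_lt h5)
  · obtain ⟨p, hpi, hp, hpn⟩ : ∃ p, i ≤ p + i ∧ appendAt X n t (p + i) ≠ 0 ∧
        p + 1 + (k + 3) < n := by
      by_cases hin : n ≤ i
      · obtain ⟨j, hj, hj'⟩ := (ht (i - n)).1
        refine ⟨j, by lia, ?_, by lia⟩
        rw [← appendAt_add X t n] at hj'
        rwa [show j + i = j + (i - n) + n by lia]
      · by_cases hil : i ≤ l
        · refine ⟨l - i, by lia, ?_, by lia⟩
          rw [Nat.sub_add_cancel hil, appendAt_of_lt X t (by lia)]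
          exact hXl
        · obtain ⟨j, hj, hj'⟩ := (ht 0).1
          refine ⟨j + n - i, by lia, ?_, by lia⟩
          rw [Nat.sub_add_cancel (by lia), appendAt_add]
          exact hj'
    have h1 := inv_pow_le_piQ hq (d := fun j => appendAt X n t (j + i)) hp
    have h2 : 1 / b ^ (p + 1) ≤ 1 / q ^ (p + 1) := by gcongr
    linarith [hη hpn]

lemma exists_holder_param {M : ℕ} (hM : 0 < M) {x : ℝ} (hx : x ∈ Set.Ioc (0 : ℝ) 1) {L : ℕ}
    (hL : 0 < L) :
    ∃ (f : Digits M → ℝ) (C : ℝ≥0), (∀ u, f u ∈ Ubases M x) ∧ ∀ u v,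
      |Real.ofDigits u - Real.ofDigits v| ≤ C * |f u - f v| ^ ((L : ℝ) / (L + 2)) := by
  obtain ⟨X, hX⟩ := exists_quasiGreedy_base M hx
  have hex := exists_digit_ne_zero hM hX
  obtain ⟨k, -, hXk⟩ := hex 0
  obtain ⟨l, hl, hXl⟩ := hex (L + 4 + k + 4)
  obtain ⟨n, hn, hXn⟩ := hex (l + k + 4 + 1)
  choose f hf hfx hfq using fun u => exists_univoque_base hM hX hXk hXl hXn hl hn
    (blockSeq_zero M L u) (boundedGaps_blockSeq hM L u)
  obtain ⟨K, hK, hlip⟩ := exists_piQ_lipschitz M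
  have hM' : (1 : ℝ) ≤ M := by exact_mod_cast hM
  set b : ℝ := (M : ℝ) + 1 with hb
  have hb0 : 0 < b := by linarith
  have hb1 : 1 ≤ b := by linarith
  set A : ℝ := K * b ^ (L + 4) * b ^ (n + 1) with hA
  have hA0 : 0 < A := by positivity
  set r : ℝ := (L : ℝ) / (L + 2) with hr
  have hr0 : 0 ≤ r := by positivity
  refine ⟨f, (b ^ L * A ^ r).toNNReal, hf, fun u v => ?_⟩
  rw [Real.coe_toNNReal _ (by positivity)]
  by_cases huv : blockSeq M L u = blockSeq M L v
  · have : u = v := funext fun i =>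
      eq_of_blockSeq_eq (m := (i + 1) * (L + 2)) (fun j _ => congrFun huv j) i <| by
        rw [Nat.mul_div_cancel _ (by lia)]
        exact Nat.le_mul_of_pos_right _ hL
    rw [this, sub_self, abs_zero]
    positivity
  obtain ⟨m, hm, hne⟩ := exists_first_ne huv
  have hsep : 1 / b ^ m ≤ A * |f u - f v| := by
    obtain ⟨hu32, -⟩ := near_top_bounds hM (by lia) (hfq u)
    obtain ⟨hv32, hvη⟩ := near_top_bounds hM (by lia) (hfq v)
    have hq : 1 < f v := by linarith
    have hqb : f v ≤ b := (hf v).1.2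
    have hη := hvη.trans_lt
      (pow_div_pow_lt (by linarith) (show L + 4 + (k + 3) < n by lia))
    have htail : ∀ w, _ := fun w =>
      (boundedGaps_blockSeq hM L w).piQ_tail_bounds hq hqb hη (m + 1)
    have happ : ∀ w, (fun i => appendAt X n (blockSeq M L w) (i + (n + m + 1))) =
        fun i => blockSeq M L w (i + (m + 1)) := fun w => by
      rw [tail_appendAt X _ (by lia)]
      congr! 3
      lia
    have hcomp : ∀ w z, (∀ i < m, blockSeq M L w i = blockSeq M L z i) →
        blockSeq M L w m < blockSeq M L z m → 1 / b ^ (L + 4) / f v ^ (n + m + 1) ≤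
          piQ M (f v) (appendAt X n (blockSeq M L z)) -
            piQ M (f v) (appendAt X n (blockSeq M L w)) := fun w z hwz hlt => by
      refine div_pow_le_piQ_sub hq (fun i hi => ?_) ?_ ?_
      · unfold appendAt
        split_ifs
        · rfl
        · exact hwz _ (by lia)
      · rwa [add_comm n m, appendAt_add, appendAt_add]
      · rw [happ, happ]
        linarith [(htail w).2, (htail z).1]
    have habs : 1 / b ^ (L + 4) / f v ^ (n + m + 1) ≤
        |piQ M (f v) (appendAt X n (blockSeq M L v)) -
          piQ M (f v) (appendAt X n (blockSeq M L u))| := by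
      rcases lt_or_gt_of_ne hne with h | h
      · exact (hcomp u v hm h).trans (le_abs_self _)
      · rw [abs_sub_comm]
        exact (hcomp v u (fun i hi => (hm i hi).symm) h).trans (le_abs_self _)
    rw [hfx v, ← hfx u] at habs
    have h1 := habs.trans (hlip _ _ _ hu32 hv32)
    have h2 : 1 / b ^ (L + 4) / b ^ (n + m + 1) ≤ 1 / b ^ (L + 4) / f v ^ (n + m + 1) := by
      gcongr
    calc 1 / b ^ m = b ^ (L + 4) * b ^ (n + 1) * (1 / b ^ (L + 4) / b ^ (n + m + 1)) := by
          field_simp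
          ring
      _ ≤ b ^ (L + 4) * b ^ (n + 1) * (K * |f u - f v|) := by
          gcongr
          exact h2.trans h1
      _ = A * |f u - f v| := by
          rw [hA]
          ring
  have hdig := Real.abs_ofDigits_sub_ofDigits_le (eq_of_blockSeq_eq hm)
  push_cast at hdig
  rw [← hb] at hdig
  refine hdig.trans ?_
  rw [mul_assoc, ← Real.mul_rpow hA0.le (abs_nonneg _)]
  have hexp : (m : ℝ) * r ≤ L + ((m / (L + 2) * L : ℕ) : ℝ) := by
    have h1 : (m : ℝ) ≤ (((m / (L + 2) : ℕ) : ℝ) + 1) * (L + 2) := by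
      have := Nat.lt_div_mul_add (a := m) (show 0 < L + 2 by lia)
      have h : m ≤ (m / (L + 2) + 1) * (L + 2) := by
        rw [Nat.add_mul]
        lia
      exact_mod_cast h
    rw [hr, mul_div_assoc', div_le_iff₀ (by positivity)]
    push_cast
    nlinarith [mul_le_mul_of_nonneg_right h1 (Nat.cast_nonneg (α := ℝ) L)]
  calc (b ^ (m / (L + 2) * L))⁻¹ ≤ b ^ L * (1 / b ^ m) ^ r := by
        rw [one_div, Real.inv_rpow (by positivity), ← Real.rpow_natCast b m,
          ← Real.rpow_mul hb0.le, ← Real.rpow_natCast b L, ← Real.rpow_natCast b (_ * L),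
          ← Real.rpow_neg hb0.le, ← Real.rpow_neg hb0.le, ← Real.rpow_add hb0]
        exact Real.rpow_le_rpow_of_exponent_le hb1 (by linarith)
    _ ≤ b ^ L * (A * |f u - f v|) ^ r := by gcongr

lemma dimH_range_ofDigits {b : ℕ} (hb : 1 < b) :
    dimH (Set.range (Real.ofDigits (b := b))) = 1 := by
  have hsub : Set.Icc (0 : ℝ) 1 ⊆ Set.range (Real.ofDigits (b := b)) := by
    rw [← Set.image_univ]
    exact Real.ofDigits_SurjOn hb
  have hne : (interior (Set.range (Real.ofDigits (b := b)))).Nonempty :=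
    ⟨1 / 2, interior_mono hsub (by rw [interior_Icc]; norm_num)⟩
  rw [Real.dimH_of_nonempty_interior hne]
  simp

/-- For every `x ∈ (0,1]`, the set `𝒰(x)` has Hausdorff dimension `1`
(Euclidean metric on `ℝ`). -/
theorem dimH_Ubases_eq_one (M : ℕ) (hM : 0 < M) (x : ℝ) (hx : x ∈ Set.Ioc (0 : ℝ) 1) :
    dimH (Ubases M x) = 1 := by
  refine le_antisymm ((dimH_mono (Set.subset_univ _)).trans_eq Real.dimH_univ) ?_
  have hlim : Filter.Tendsto (fun L : ℕ => ENNReal.ofReal ((L : ℝ) / (L + 2))) Filter.atTop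
      (nhds 1) := by
    rw [← ENNReal.ofReal_one]
    exact ENNReal.tendsto_ofReal (tendsto_natCast_div_add_atTop (2 : ℝ))
  refine le_of_tendsto hlim ?_
  filter_upwards [Filter.eventually_gt_atTop 0] with L hL
  obtain ⟨f, C, hf, h⟩ := exists_holder_param hM hx hL
  have hr : 0 < ((L : ℝ≥0) / (L + 2)) := by positivity
  have h1 := mul_dimH_range_le f Real.ofDigits (C := C) hr (by simpa using h)
  rw [dimH_range_ofDigits (by lia), mul_one] at h1
  refine le_trans (le_of_eq ?_) (h1.trans (dimH_mono (Set.range_subset_iff.mpr hf)))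
  rw [← ENNReal.ofReal_coe_nnreal]
  simp

end Expansions
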